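/- Let A, X ∈ ℂ^{n₁×n₁×n₃} be third-order tensors, ind(A) = k, and let A^D be the Drazin inverse of A. Then X is a GD inverse of A (i.e., A ⋆ X ⋆ A = A, X ⋆ A^{k+1} = A^k, and A^{k+1} ⋆ X = A^k) if and only if A ⋆ X ⋆ A = A and A^D ⋆ A ⋆ X = X ⋆ A^D ⋆ A. -/

import Mathlib

open Matrix BigOperators

/-- A third-order complex tensor in `ℂ^{n₁ × n₂ × n₃}`, given by its frontal slices. -/
abbrev Tensor3 (n₁ n₂ n₃ : ℕ) := Fin n₃ → Matrix (Fin n₁) (Fin n₂) ℂ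

/-- Mode-3 product of a tensor with an `n₃ × n₃` matrix: the slices of the result are the
indicated linear combinations of the slices of `A`. -/
noncomputable def mode3 {n₁ n₂ n₃ : ℕ} (M : Matrix (Fin n₃) (Fin n₃) ℂ) (A : Tensor3 n₁ n₂ n₃) :
    Tensor3 n₁ n₂ n₃ :=
  fun i => ∑ j, M i j • A j

/-- The M-product `A ⋆_M B`: slice-wise matrix product in the transformed (hat) domain,
transformed back by `M⁻¹`. -/
noncomputable def mprod {n₁ n₂ l n₃ : ℕ} (M : Matrix (Fin n₃) (Fin n₃) ℂ)
    (A : Tensor3 n₁ n₂ n₃) (B : Tensor3 n₂ l n₃) : Tensor3 n₁ l n₃ :=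
  mode3 M⁻¹ (fun i => mode3 M A i * mode3 M B i)

/-- The identity tensor: every slice of its mode-3 transform is the identity matrix. -/
noncomputable def idT (n₁ : ℕ) {n₃ : ℕ} (M : Matrix (Fin n₃) (Fin n₃) ℂ) : Tensor3 n₁ n₁ n₃ :=
  mode3 M⁻¹ (fun _ => (1 : Matrix (Fin n₁) (Fin n₁) ℂ))

/-- Powers of a square tensor with respect to the M-product. -/
noncomputable def mpow {n₁ n₃ : ℕ} (M : Matrix (Fin n₃) (Fin n₃) ℂ) (A : Tensor3 n₁ n₁ n₃) :
    ℕ → Tensor3 n₁ n₁ n₃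
  | 0 => idT n₁ M
  | k + 1 => mprod M (mpow M A k) A

/-- Conjugate transpose with respect to the M-product: slice-wise conjugate transpose in the
transformed domain. -/
noncomputable def ctrans {n₁ n₂ n₃ : ℕ} (M : Matrix (Fin n₃) (Fin n₃) ℂ) (A : Tensor3 n₁ n₂ n₃) :
    Tensor3 n₂ n₁ n₃ :=
  mode3 M⁻¹ (fun i => (mode3 M A i)ᴴ)

/-- Index of a square complex matrix: the least `k ≥ 0` with `rank(B^k) = rank(B^{k+1})`. -/
noncomputable def matIndex {n : ℕ} (B : Matrix (Fin n) (Fin n) ℂ) : ℕ :=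
  sInf {k : ℕ | (B ^ k).rank = (B ^ (k + 1)).rank}

/-- Index of a tensor: the maximum of the indices of the slices of its mode-3 transform. -/
noncomputable def tIndex {n₁ n₃ : ℕ} (M : Matrix (Fin n₃) (Fin n₃) ℂ)
    (A : Tensor3 n₁ n₁ n₃) : ℕ :=
  Finset.univ.sup fun i => matIndex (mode3 M A i)

/-- `X` is a GD inverse of `A` with exponent `k`:
`A ⋆ X ⋆ A = A`, `X ⋆ A^{k+1} = A^k`, `A^{k+1} ⋆ X = A^k`. -/
def IsGD {n₁ n₃ : ℕ} (M : Matrix (Fin n₃) (Fin n₃) ℂ) (A X : Tensor3 n₁ n₁ n₃)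
    (k : ℕ) : Prop :=
  mprod M (mprod M A X) A = A ∧
  mprod M X (mpow M A (k + 1)) = mpow M A k ∧
  mprod M (mpow M A (k + 1)) X = mpow M A k

/-- `X` is the Drazin inverse of `A` with exponent `k`. -/
def IsDrazin {n₁ n₃ : ℕ} (M : Matrix (Fin n₃) (Fin n₃) ℂ) (A X : Tensor3 n₁ n₁ n₃)
    (k : ℕ) : Prop :=
  mprod M X (mpow M A (k + 1)) = mpow M A k ∧
  mprod M (mprod M X A) X = X ∧
  mprod M X A = mprod M A X

/-- `X` is the Moore–Penrose inverse of `A`. -/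
def IsMP {n₁ n₃ : ℕ} (M : Matrix (Fin n₃) (Fin n₃) ℂ) (A X : Tensor3 n₁ n₁ n₃) : Prop :=
  mprod M (mprod M A X) A = A ∧
  mprod M (mprod M X A) X = X ∧
  ctrans M (mprod M A X) = mprod M A X ∧
  ctrans M (mprod M X A) = mprod M X A

/-- In a monoid, if `d` is a Drazin inverse of `a` with exponent `k`, then the equations
`x * a ^ (k + 1) = a ^ k = a ^ (k + 1) * x` for an inner inverse `x` of `a` say exactly that `x`
commutes with the idempotent `d * a`. -/
theorem pow_eqs_iff_commute_of_drazin {R : Type*} [Monoid R] {a x d : R} {k : ℕ}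
    (h₁ : d * a ^ (k + 1) = a ^ k) (h₂ : d * a * d = d) (h₃ : d * a = a * d)
    (hx : a * x * a = a) :
    (x * a ^ (k + 1) = a ^ k ∧ a ^ (k + 1) * x = a ^ k) ↔ d * a * x = x * d * a := by
  have hc : Commute d a := h₃
  constructor
  · rintro ⟨hl, hr⟩
    have hid : IsIdempotentElem (d * a) := by
      rw [IsIdempotentElem, ← mul_assoc, h₂]
    have hp : d * a = d ^ (k + 1) * a ^ (k + 1) := by
      rw [← hc.mul_pow, hid.pow_succ_eq]
    have hp' : d * a = a ^ (k + 1) * d ^ (k + 1) :=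
      hp.trans (hc.pow_pow (k + 1) (k + 1)).eq
    calc d * a * x = d ^ (k + 1) * a ^ k := by rw [hp, mul_assoc, hr]
      _ = a ^ k * d ^ (k + 1) := (hc.pow_pow (k + 1) k).eq
      _ = x * (d * a) := by rw [hp', ← mul_assoc, hl]
      _ = x * d * a := (mul_assoc _ _ _).symm
  · intro h
    have hl : d * a * a ^ (k + 1) = a ^ (k + 1) := by
      rw [h₃, mul_assoc, h₁, ← pow_succ']
    have hr : a ^ (k + 1) * (d * a) = a ^ (k + 1) := by
      rw [← ((hc.mul_left (Commute.refl a)).pow_right (k + 1)).eq, hl]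
    constructor
    · calc x * a ^ (k + 1) = x * d * a * a ^ (k + 1) := by
            conv_lhs => rw [← hl]
            simp only [mul_assoc]
        _ = d * (a * x * a) * a ^ k := by
            rw [← h, pow_succ']
            simp only [mul_assoc]
        _ = a ^ k := by rw [hx, mul_assoc, ← pow_succ', h₁]
    · calc a ^ (k + 1) * x = a ^ (k + 1) * (d * a * x) := by
            rw [← mul_assoc, hr]
        _ = a ^ k * (a * x * a) * d := by
            rw [h, mul_assoc x, h₃, pow_succ]
            simp only [mul_assoc]
        _ = a ^ k := by
            rw [hx, ← pow_succ, ← (hc.pow_right (k + 1)).eq, h₁]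

theorem mode3_mode3 {n₁ n₂ n₃ : ℕ} (M N : Matrix (Fin n₃) (Fin n₃) ℂ) (A : Tensor3 n₁ n₂ n₃) :
    mode3 M (mode3 N A) = mode3 (M * N) A := by
  funext i
  simp only [mode3, Matrix.mul_apply, Finset.smul_sum, Finset.sum_smul, smul_smul]
  exact Finset.sum_comm

theorem mode3_one {n₁ n₂ n₃ : ℕ} (A : Tensor3 n₁ n₂ n₃) :
    mode3 (1 : Matrix (Fin n₃) (Fin n₃) ℂ) A = A := by
  funext i
  simp [mode3, Matrix.one_apply]

section Transform

variable {n₁ n₂ n₃ : ℕ} {M : Matrix (Fin n₃) (Fin n₃) ℂ}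

theorem mode3_mode3_inv (hM : IsUnit M) (A : Tensor3 n₁ n₂ n₃) :
    mode3 M (mode3 M⁻¹ A) = A := by
  rw [mode3_mode3, Matrix.mul_nonsing_inv M ((Matrix.isUnit_iff_isUnit_det M).mp hM), mode3_one]

theorem mode3_injective (hM : IsUnit M) :
    Function.Injective (mode3 M : Tensor3 n₁ n₂ n₃ → Tensor3 n₁ n₂ n₃) :=
  Function.LeftInverse.injective (g := mode3 M⁻¹) fun A => by
    rw [mode3_mode3, Matrix.nonsing_inv_mul M ((Matrix.isUnit_iff_isUnit_det M).mp hM), mode3_one]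

theorem mode3_mprod (hM : IsUnit M) (A B : Tensor3 n₁ n₁ n₃) :
    mode3 M (mprod M A B) = mode3 M A * mode3 M B :=
  mode3_mode3_inv hM _

theorem mode3_mpow (hM : IsUnit M) (A : Tensor3 n₁ n₁ n₃) (k : ℕ) :
    mode3 M (mpow M A k) = mode3 M A ^ k := by
  induction k with
  | zero => exact mode3_mode3_inv hM _
  | succ k ih => rw [mpow, mode3_mprod hM, ih, pow_succ]

end Transform

/-- with `A^D` the Drazin inverse of `A` and `k = ind(A)`, `X` is a GD inverse of
`A` iff `A ⋆ X ⋆ A = A` and `A^D ⋆ A ⋆ X = X ⋆ A^D ⋆ A`. -/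
theorem gd_iff_drazin_commutation {n₁ n₃ : ℕ} (hn₁ : 0 < n₁) (hn₃ : 0 < n₃)
    (M : Matrix (Fin n₃) (Fin n₃) ℂ) (hM : IsUnit M)
    (A X AD : Tensor3 n₁ n₁ n₃) (k : ℕ) (hk : tIndex M A = k)
    (hAD : IsDrazin M A AD k) :
    IsGD M A X k ↔
      (mprod M (mprod M A X) A = A ∧
        mprod M (mprod M AD A) X = mprod M (mprod M X AD) A) := by
  have heq (B C : Tensor3 n₁ n₁ n₃) : B = C ↔ mode3 M B = mode3 M C :=
    (mode3_injective hM).eq_iff.symm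
  obtain ⟨h₁, h₂, h₃⟩ := hAD
  rw [heq] at h₁ h₂ h₃
  rw [IsGD, heq (mprod M (mprod M A X) A), heq (mprod M X _), heq (mprod M (mpow M A _) X),
    heq (mprod M (mprod M AD A) X)]
  simp only [mode3_mprod hM, mode3_mpow hM] at h₁ h₂ h₃ ⊢
  exact and_congr_right fun hx => pow_eqs_iff_commute_of_drazin h₁ h₂ h₃ hx
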